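/- arXiv:math/9903036 — 3 statements merged into one kernel-verified Lean document; each statement's English description precedes it below -/
import Mathlib

section
/- Let V be a finite type and r : V → V → Prop an irreflexive relation such that every vertex has at most one r-predecessor, i.e. for every v ∈ V and all u, w ∈ V, if r u v and r w v then u = w. Let G be the simple graph on V whose adjacency relation is u ~ v ↔ (r u v ∨ r v u). If G contains a cycle, then r has a directed cycle: there exist k ≥ 1 and vertices v₀, v₁, …, v_k with v_k = v₀, the vertices v₀, …, v_{k−1} pairwise distinct, and r v_i v_{i+1} for all 0 ≤ i < k. (This is the fact that for graphs in which at most one edge ends at each vertex — the situation of polyvector fields with linear coefficients — every unoriented cycle is an oriented cycle.) -/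
/-- A pair in the transitive closure of `r` is joined by a directed walk of positive length. -/
lemma exists_directed_walk_of_transGen {V : Type*} {r : V → V → Prop} {x y : V}
    (h : Relation.TransGen r x y) :
    ∃ (k : ℕ) (v : ℕ → V), 1 ≤ k ∧ v 0 = x ∧ v k = y ∧ ∀ i, i < k → r (v i) (v (i + 1)) := by
  induction h using Relation.TransGen.head_induction_on with
  | single h =>
    rename_i a
    refine ⟨1, fun n => Nat.casesOn n a fun _ => y, le_rfl, rfl, rfl, fun i hi => ?_⟩
    obtain rfl : i = 0 := by omega
    exact h
  | head h _ ih =>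
    rename_i a c _
    obtain ⟨k, v, -, h0, hk, hv⟩ := ih
    refine ⟨k + 1, fun n => Nat.casesOn n a v, by omega, rfl, hk, fun i hi => ?_⟩
    cases i with
    | zero => simpa [h0] using h
    | succ i => exact hv i (by omega)

/-- If some vertex is related to itself by the transitive closure of `r`, then `r` has a
directed cycle with pairwise distinct vertices. -/
lemma exists_directed_cycle_of_transGen_self {V : Type*} {r : V → V → Prop} {x : V}
    (h : Relation.TransGen r x x) :
    ∃ (k : ℕ) (v : ℕ → V), 1 ≤ k ∧ v k = v 0 ∧
      (∀ i j, i < k → j < k → v i = v j → i = j) ∧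
      (∀ i, i < k → r (v i) (v (i + 1))) := by
  classical
  have hex : ∃ k, ∃ v : ℕ → V, 1 ≤ k ∧ v k = v 0 ∧ ∀ i, i < k → r (v i) (v (i + 1)) := by
    obtain ⟨k, v, hk, h0, hkx, hv⟩ := exists_directed_walk_of_transGen h
    exact ⟨k, v, hk, hkx.trans h0.symm, hv⟩
  obtain ⟨v, hk, hclosed, hv⟩ := Nat.find_spec hex
  have hne : ∀ i j, i < j → j < Nat.find hex → v i ≠ v j := by
    intro i j hij hj heq
    refine Nat.find_min hex (m := j - i) (by omega)
      ⟨fun n => v (i + n), by omega, ?_, fun n hn => hv (i + n) (by omega)⟩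
    simp [Nat.add_sub_cancel' hij.le, heq]
  refine ⟨Nat.find hex, v, hk, hclosed, fun i j hi hj heq => ?_, hv⟩
  rcases lt_trichotomy i j with hij | hij | hij
  · exact absurd heq (hne i j hij hj)
  · exact hij
  · exact absurd heq.symm (hne j i hij hi)

/-- If `r` has unique predecessors, then its underlying simple graph has no cycle unless the
transitive closure of `r` relates some vertex to itself. -/
lemma exists_transGen_self_of_not_isAcyclic {V : Type*} [Finite V] {r : V → V → Prop}
    (hpred : ∀ v u w, r u v → r w v → u = w) {G : SimpleGraph V}
    (hadj : ∀ u v, G.Adj u v → r u v ∨ r v u) (hcyc : ¬ G.IsAcyclic) :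
    ∃ x, Relation.TransGen r x x := by
  classical
  by_contra! hirr
  refine hcyc fun a c hc => ?_
  have : Std.Irrefl (Function.swap (Relation.TransGen r)) := ⟨hirr⟩
  have : IsTrans V (Function.swap (Relation.TransGen r)) := ⟨fun _ _ _ h₁ h₂ => h₂.trans h₁⟩
  obtain ⟨x, hx, hmax⟩ := (Finite.wellFounded_of_trans_of_irrefl
    (Function.swap (Relation.TransGen r))).has_min {x | x ∈ c.support} ⟨a, c.start_mem_support⟩
  have hd := hc.rotate hx
  have hsub : ∀ y ∈ (c.rotate x hx).support, G.Adj y x → r y x := by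
    intro y hy hyx
    refine (hadj y x hyx).resolve_right fun hxy => hmax y ?_ (.single hxy)
    simpa using hy
  exact hd.snd_ne_penultimate (hpred x _ _
    (hsub _ (SimpleGraph.Walk.getVert_mem_support _ _)
      (SimpleGraph.Walk.adj_snd hd.not_nil).symm)
    (hsub _ (SimpleGraph.Walk.getVert_mem_support _ _)
      (SimpleGraph.Walk.adj_penultimate hd.not_nil)))

/-- Let `r` be an irreflexive relation on a finite type `V` in which every
vertex has at most one `r`-predecessor, and let `G` be the simple graph with
adjacency `u ~ v ↔ (r u v ∨ r v u)`.  If `G` contains a cycle, then `r` has a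
directed cycle: there are `k ≥ 1` and vertices `v₀, …, v_k` with `v_k = v₀`,
`v₀, …, v_{k−1}` pairwise distinct, and `r v_i v_{i+1}` for `0 ≤ i < k`. -/
theorem unoriented_cycle_is_oriented_of_unique_pred
    {V : Type*} [Fintype V] (r : V → V → Prop)
    (hirr : ∀ v, ¬ r v v)
    (hpred : ∀ v u w, r u v → r w v → u = w)
    (G : SimpleGraph V) (hadj : ∀ u v, G.Adj u v ↔ (r u v ∨ r v u))
    (hcyc : ¬ G.IsAcyclic) :
    ∃ (k : ℕ) (v : ℕ → V), 1 ≤ k ∧ v k = v 0 ∧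
      (∀ i j, i < k → j < k → v i = v j → i = j) ∧
      (∀ i, i < k → r (v i) (v (i + 1))) := by
  obtain ⟨x, hx⟩ := exists_transGen_self_of_not_isAcyclic hpred (fun u v => (hadj u v).1) hcyc
  exact exists_directed_cycle_of_transGen_self hx
end

section
/- Let d be a natural number and c : Fin d → Fin d → Fin d → ℝ a family of constants which is antisymmetric in its first two arguments: c i j k = − c j i k for all i, j, k. On the polynomial algebra A = MvPolynomial (Fin d) ℝ define the bilinear bracket B(f,g) := Σ_{i,j,k} c i j k • ( X k * (pderiv i f) * (pderiv j g) ). Then B satisfies the Jacobi identity B(B(f,g),h) + B(B(g,h),f) + B(B(h,f),g) = 0 for all f, g, h ∈ A if and only if the constants c satisfy the Jacobi identity Σ_{l} ( c i j l * c l k m + c j k l * c l i m + c k i l * c l j m ) = 0 for all i, j, k, m. (This is the statement that a bivector field α = Σ c^k_{ij} x_k ∂_i ∧ ∂_j with linear coefficients satisfies [α,α] = 0, i.e. defines the Kirillov–Poisson structure on 𝔤*, exactly when c^k_{ij} are the structure constants of a Lie algebra.) -/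
open MvPolynomial

/-- The bracket `B(f,g) = Σ_{i,j,k} c^k_{ij} • (x_k · ∂_i f · ∂_j g)` associated
to a bivector field with linear coefficients on `ℝ^d`. -/
noncomputable def linBracket (d : ℕ) (c : Fin d → Fin d → Fin d → ℝ)
    (f g : MvPolynomial (Fin d) ℝ) : MvPolynomial (Fin d) ℝ :=
  ∑ i : Fin d, ∑ j : Fin d, ∑ k : Fin d,
    c i j k • (MvPolynomial.X k * MvPolynomial.pderiv i f * MvPolynomial.pderiv j g)

/-- The derivation `g ↦ B(f,g)`. -/
noncomputable def linBracketDerivation (d : ℕ) (c : Fin d → Fin d → Fin d → ℝ)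
    (f : MvPolynomial (Fin d) ℝ) :
    Derivation ℝ (MvPolynomial (Fin d) ℝ) (MvPolynomial (Fin d) ℝ) :=
  ∑ i : Fin d, ∑ j : Fin d, ∑ k : Fin d, (c i j k • (X k * pderiv i f)) • pderiv j

section LinBracket

variable {d : ℕ} {c : Fin d → Fin d → Fin d → ℝ}

theorem linBracketDerivation_apply (f g : MvPolynomial (Fin d) ℝ) :
    linBracketDerivation d c f g = linBracket d c f g := by
  simp only [linBracketDerivation, linBracket, ← Derivation.coeFnAddMonoidHom_apply, map_sum,
    Finset.sum_apply]
  simp [Derivation.coeFnAddMonoidHom_apply]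

theorem linBracket_antisymm (hanti : ∀ i j k, c i j k = - c j i k)
    (f g : MvPolynomial (Fin d) ℝ) : linBracket d c f g = - linBracket d c g f := by
  unfold linBracket
  rw [Finset.sum_comm]
  simp only [← Finset.sum_neg_distrib]
  refine Finset.sum_congr rfl fun i _ => Finset.sum_congr rfl fun j _ =>
    Finset.sum_congr rfl fun k _ => ?_
  rw [hanti j i k, neg_smul, mul_right_comm]

theorem linBracket_neg_left (f g : MvPolynomial (Fin d) ℝ) :
    linBracket d c (-f) g = - linBracket d c f g := by
  simp [linBracket]

theorem linBracket_X_X (i j : Fin d) :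
    linBracket d c (X i) (X j) = ∑ k : Fin d, c i j k • (X k : MvPolynomial (Fin d) ℝ) := by
  unfold linBracket
  rw [Finset.sum_eq_single i, Finset.sum_eq_single j]
  · simp
  · intro b _ hb
    simp [pderiv_X_of_ne hb.symm]
  · simp
  · intro b _ hb
    simp [pderiv_X_of_ne hb.symm]
  · simp

theorem linBracket_linBracket_X (hanti : ∀ i j k, c i j k = - c j i k) (i j k : Fin d) :
    linBracket d c (linBracket d c (X i) (X j)) (X k) =
      ∑ m : Fin d, (∑ l : Fin d, c i j l * c l k m) • (X m : MvPolynomial (Fin d) ℝ) := by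
  rw [linBracket_antisymm hanti, ← linBracketDerivation_apply, linBracket_X_X, map_sum,
    ← Finset.sum_neg_distrib]
  simp only [Derivation.map_smul, linBracketDerivation_apply, ← smul_neg,
    ← linBracket_antisymm hanti]
  simp only [linBracket_X_X, Finset.smul_sum, Finset.sum_smul, smul_smul]
  exact Finset.sum_comm

theorem linBracket_jacobiator_X (hanti : ∀ i j k, c i j k = - c j i k) (i j k : Fin d) :
    linBracket d c (linBracket d c (X i) (X j)) (X k)
        + linBracket d c (linBracket d c (X j) (X k)) (X i)
        + linBracket d c (linBracket d c (X k) (X i)) (X j) =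
      ∑ m : Fin d, (∑ l : Fin d, (c i j l * c l k m + c j k l * c l i m + c k i l * c l j m)) •
        (X m : MvPolynomial (Fin d) ℝ) := by
  simp only [linBracket_linBracket_X hanti, Finset.sum_add_distrib, add_smul]

/-- The Jacobiator is, up to sign, a derivation in its last argument. -/
theorem linBracket_jacobiator_eq_neg_derivation (hanti : ∀ i j k, c i j k = - c j i k)
    (f g h : MvPolynomial (Fin d) ℝ) :
    linBracket d c (linBracket d c f g) h + linBracket d c (linBracket d c g h) f
        + linBracket d c (linBracket d c h f) g =
      - (⁅linBracketDerivation d c f, linBracketDerivation d c g⁆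
          - linBracketDerivation d c (linBracket d c f g)) h := by
  rw [Derivation.sub_apply, Derivation.commutator_apply]
  simp only [linBracketDerivation_apply]
  rw [linBracket_antisymm hanti (linBracket d c g h) f, linBracket_antisymm hanti h f,
    linBracket_neg_left, linBracket_antisymm hanti (linBracket d c f h) g]
  ring

theorem linBracket_jacobi_of_X (hanti : ∀ i j k, c i j k = - c j i k)
    {f g : MvPolynomial (Fin d) ℝ}
    (hX : ∀ k, linBracket d c (linBracket d c f g) (X k)
      + linBracket d c (linBracket d c g (X k)) f
      + linBracket d c (linBracket d c (X k) f) g = 0) (h : MvPolynomial (Fin d) ℝ) :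
    linBracket d c (linBracket d c f g) h + linBracket d c (linBracket d c g h) f
      + linBracket d c (linBracket d c h f) g = 0 := by
  have hD : ⁅linBracketDerivation d c f, linBracketDerivation d c g⁆
      - linBracketDerivation d c (linBracket d c f g) = 0 :=
    MvPolynomial.derivation_ext fun k => by
      simpa only [linBracket_jacobiator_eq_neg_derivation hanti, neg_eq_zero,
        Derivation.zero_apply] using hX k
  rw [linBracket_jacobiator_eq_neg_derivation hanti, hD, Derivation.zero_apply, neg_zero]

end LinBracket

/-- For constants `c` antisymmetric in the first two arguments, the bracket
`B(f,g) = Σ c^k_{ij} x_k ∂_i f ∂_j g` satisfies the Jacobi identity on the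
polynomial algebra iff `c` satisfies the Jacobi identity of structure constants
of a Lie algebra, i.e. iff the bivector field `α = Σ c^k_{ij} x_k ∂_i ∧ ∂_j`
with linear coefficients satisfies `[α,α] = 0` (the Kirillov–Poisson case). -/
theorem linear_bracket_jacobi_iff_structure_constants (d : ℕ)
    (c : Fin d → Fin d → Fin d → ℝ)
    (hanti : ∀ i j k, c i j k = - c j i k) :
    (∀ f g h : MvPolynomial (Fin d) ℝ,
        linBracket d c (linBracket d c f g) h
          + linBracket d c (linBracket d c g h) f
          + linBracket d c (linBracket d c h f) g = 0) ↔
    (∀ i j k m : Fin d,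
        ∑ l : Fin d, (c i j l * c l k m + c j k l * c l i m + c k i l * c l j m) = 0) := by
  constructor
  · intro hJ i j k m
    have hsum := (linBracket_jacobiator_X hanti i j k).symm.trans (hJ (X i) (X j) (X k))
    exact Fintype.linearIndependent_iff.mp (linearIndependent_X (Fin d) ℝ) _ hsum m
  · intro hc f g h
    have hXXX (i j k : Fin d) := (linBracket_jacobiator_X hanti i j k).trans <|
      Finset.sum_eq_zero fun m _ => by rw [hc, zero_smul]
    have hXX (i j : Fin d) := linBracket_jacobi_of_X hanti (hXXX i j)
    have hX (i : Fin d) (g : MvPolynomial (Fin d) ℝ) :=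
      linBracket_jacobi_of_X hanti (f := g) (g := X i) fun j => by
        rw [← hXX i j g]
        abel
    refine linBracket_jacobi_of_X hanti (fun k => ?_) h
    rw [← hX k g f]
    abel
end

section
/- For q ∈ ℝ let θ_q : ℝ × ℝ → ℝ be defined by θ_q(x,y) := Complex.arg( (q : ℂ) − (x + y·I) ). Then: (a) for each q ∈ ℝ the function θ_q is infinitely differentiable on the open upper half-plane ℝ × (0,∞); and (b) the Jacobian determinant J(x,y) := (∂ₓθ₀)(x,y)·(∂_yθ₁)(x,y) − (∂_yθ₀)(x,y)·(∂ₓθ₁)(x,y) of the map (x,y) ↦ (θ₀(x,y), θ₁(x,y)) is Lebesgue-integrable over ℝ × (0,∞). (This is the absolute convergence, asserted in Lemma 2.1, of the integral ∫_{C⁺_{1,2}} dφ_{e₁} ∧ dφ_{e₂} defining the Kontsevich weight of the graph with one vertex of the first type and two vertices of the second type, after using the affine group action to fix the two boundary points at 0 and 1.) -/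
open MeasureTheory

/-- The angle `θ_q(x,y) = Arg(q − (x + y·I))` of the point `x + y·I` of the
upper half-plane seen from the boundary point `q ∈ ℝ`. -/
noncomputable def theta (q : ℝ) (x y : ℝ) : ℝ :=
  Complex.arg ((q : ℂ) - ((x : ℂ) + (y : ℂ) * Complex.I))

/-- The Jacobian determinant of the map `(x,y) ↦ (θ₀(x,y), θ₁(x,y))`:
`J = ∂ₓθ₀ · ∂_yθ₁ − ∂_yθ₀ · ∂ₓθ₁`. -/
noncomputable def thetaJacobian (x y : ℝ) : ℝ :=
  (deriv (fun t => theta 0 t y) x) * (deriv (fun t => theta 1 x t) y)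
    - (deriv (fun t => theta 0 x t) y) * (deriv (fun t => theta 1 t y) x)

/-- The angle function is smooth at every point with positive second coordinate. -/
lemma contDiffAt_theta (q : ℝ) {p : ℝ × ℝ} (hp : 0 < p.2) {n : WithTop ℕ∞} :
    ContDiffAt ℝ n (fun p : ℝ × ℝ => theta q p.1 p.2) p := by
  have hslit : (q : ℂ) - ((p.1 : ℂ) + (p.2 : ℂ) * Complex.I) ∈ Complex.slitPlane := by
    right
    simpa using hp.ne'
  have hlin : ContDiff ℝ n
      (fun p : ℝ × ℝ => (q : ℂ) - ((p.1 : ℂ) + (p.2 : ℂ) * Complex.I)) := by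
    have h₁ : ContDiff ℝ n (fun p : ℝ × ℝ => (p.1 : ℂ)) :=
      Complex.ofRealCLM.contDiff.comp contDiff_fst
    have h₂ : ContDiff ℝ n (fun p : ℝ × ℝ => (p.2 : ℂ)) :=
      Complex.ofRealCLM.contDiff.comp contDiff_snd
    exact contDiff_const.sub (h₁.add (h₂.mul contDiff_const))
  have hlog := ((Complex.contDiffAt_log hslit (n := n)).restrict_scalars ℝ).comp p
    hlin.contDiffAt
  have him := Complex.imCLM.contDiff.contDiffAt.comp p hlog
  exact him.congr_of_eventuallyEq (Filter.Eventually.of_forall fun r => by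
    simp [theta, Complex.log_im])

/-- The derivative of the argument along a differentiable curve in the slit plane. -/
lemma hasDerivAt_arg_comp {f : ℝ → ℂ} {f' : ℂ} {t : ℝ} (hf : HasDerivAt f f' t)
    (ht : f t ∈ Complex.slitPlane) :
    HasDerivAt (fun s => Complex.arg (f s)) (f' / f t).im t := by
  have h := Complex.imCLM.hasFDerivAt.comp_hasDerivAt t (hf.clog_real ht)
  simpa [Function.comp_def, Complex.log_im] using h

lemma hasDerivAt_theta_fst (q x : ℝ) {y : ℝ} (hy : 0 < y) :
    HasDerivAt (fun t => theta q t y) (-y / ((x - q) ^ 2 + y ^ 2)) x := by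
  have hf : HasDerivAt (fun t : ℝ => (q : ℂ) - ((t : ℂ) + (y : ℂ) * Complex.I)) (-1) x :=
    ((Complex.ofRealCLM.hasDerivAt (x := x)).add_const _).const_sub _ |>.congr_deriv (by simp)
  have h := hasDerivAt_arg_comp hf (Or.inr (by simpa using hy.ne'))
  refine h.congr_deriv ?_
  rw [Complex.div_im]
  simp [Complex.normSq_apply]
  ring

lemma hasDerivAt_theta_snd (q x : ℝ) {y : ℝ} (hy : 0 < y) :
    HasDerivAt (fun t => theta q x t) ((x - q) / ((x - q) ^ 2 + y ^ 2)) y := by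
  have hf : HasDerivAt (fun t : ℝ => (q : ℂ) - ((x : ℂ) + (t : ℂ) * Complex.I))
      (-Complex.I) y :=
    (((Complex.ofRealCLM.hasDerivAt (x := y)).mul_const Complex.I).const_add _).const_sub _
      |>.congr_deriv (by simp)
  have h := hasDerivAt_arg_comp hf (Or.inr (by simpa using hy.ne'))
  refine h.congr_deriv ?_
  rw [Complex.div_im]
  simp [Complex.normSq_apply]
  ring

lemma thetaJacobian_eq (x : ℝ) {y : ℝ} (hy : 0 < y) :
    thetaJacobian x y = y / ((x ^ 2 + y ^ 2) * ((x - 1) ^ 2 + y ^ 2)) := by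
  have h₀ : x ^ 2 + y ^ 2 ≠ 0 := by positivity
  have h₁ : (x - 1) ^ 2 + y ^ 2 ≠ 0 := by positivity
  rw [thetaJacobian, (hasDerivAt_theta_fst 0 x hy).deriv, (hasDerivAt_theta_snd 1 x hy).deriv,
    (hasDerivAt_theta_snd 0 x hy).deriv, (hasDerivAt_theta_fst 1 x hy).deriv, sub_zero]
  field_simp
  ring

lemma poisson_kernel_eq (q x : ℝ) {y : ℝ} (hy : 0 < y) :
    y / ((x - q) ^ 2 + y ^ 2) = y⁻¹ * (1 + ((x - q) / y) ^ 2)⁻¹ := by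
  field_simp
  ring

lemma integrable_poisson_kernel (q : ℝ) {y : ℝ} (hy : 0 < y) :
    Integrable (fun x : ℝ => y / ((x - q) ^ 2 + y ^ 2)) := by
  simp_rw [poisson_kernel_eq q _ hy]
  exact ((integrable_inv_one_add_sq.comp_div hy.ne').comp_sub_right q).const_mul _

lemma integral_poisson_kernel (q : ℝ) {y : ℝ} (hy : 0 < y) :
    ∫ x : ℝ, y / ((x - q) ^ 2 + y ^ 2) = Real.pi := by
  simp_rw [poisson_kernel_eq q _ hy]
  rw [integral_const_mul, integral_sub_right_eq_self (fun x : ℝ => (1 + (x / y) ^ 2)⁻¹) q,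
    Measure.integral_comp_div (fun x : ℝ => (1 + x ^ 2)⁻¹) y, integral_univ_inv_one_add_sq,
    abs_of_pos hy, smul_eq_mul, inv_mul_cancel_left₀ hy.ne']

/-- The Poisson kernel damped by `(1 + y ^ 2)⁻¹` is integrable over the upper half-plane. -/
lemma integrableOn_poisson_kernel_mul (q : ℝ) :
    IntegrableOn (fun p : ℝ × ℝ => p.2 / ((p.1 - q) ^ 2 + p.2 ^ 2) * (1 + p.2 ^ 2)⁻¹)
      (Set.univ ×ˢ Set.Ioi (0 : ℝ)) volume := by
  rw [IntegrableOn, Measure.volume_eq_prod, ← Measure.prod_restrict, Measure.restrict_univ,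
    integrable_prod_iff' (by fun_prop)]
  constructor
  · filter_upwards [ae_restrict_mem measurableSet_Ioi] with y hy
    exact (integrable_poisson_kernel q hy).mul_const _
  · refine (integrable_inv_one_add_sq.integrableOn.const_mul Real.pi).congr ?_
    filter_upwards [ae_restrict_mem measurableSet_Ioi] with y hy
    have hy' : 0 < y := hy
    rw [← integral_poisson_kernel q hy', ← integral_mul_const]
    refine integral_congr_ae (Filter.Eventually.of_forall fun x => ?_)
    exact (Real.norm_of_nonneg (by positivity)).symm

lemma jacobian_le_poisson_kernel (x : ℝ) {y : ℝ} (hy : 0 < y) :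
    y / ((x ^ 2 + y ^ 2) * ((x - 1) ^ 2 + y ^ 2)) ≤
      2 * (y / ((x - 0) ^ 2 + y ^ 2) * (1 + y ^ 2)⁻¹ +
        y / ((x - 1) ^ 2 + y ^ 2) * (1 + y ^ 2)⁻¹) := by
  have h₀ : 0 < x ^ 2 + y ^ 2 := by positivity
  have h₁ : 0 < (x - 1) ^ 2 + y ^ 2 := by positivity
  have h₂ : 0 < 1 + y ^ 2 := by positivity
  have hsum : 1 + y ^ 2 ≤ 2 * ((x ^ 2 + y ^ 2) + ((x - 1) ^ 2 + y ^ 2)) := by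
    nlinarith [sq_nonneg (2 * x - 1), sq_nonneg y]
  have hrhs : 2 * (y / ((x - 0) ^ 2 + y ^ 2) * (1 + y ^ 2)⁻¹ +
      y / ((x - 1) ^ 2 + y ^ 2) * (1 + y ^ 2)⁻¹) =
      y / ((x ^ 2 + y ^ 2) * ((x - 1) ^ 2 + y ^ 2)) *
        (2 * ((x ^ 2 + y ^ 2) + ((x - 1) ^ 2 + y ^ 2)) / (1 + y ^ 2)) := by
    rw [sub_zero]
    field_simp
    ring
  rw [hrhs]
  exact le_mul_of_one_le_right (by positivity) ((one_le_div h₂).2 hsum)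

/-- (a) Each angle function `θ_q` is infinitely differentiable on the open
upper half-plane, and (b) the Jacobian determinant of `(θ₀, θ₁)` is
Lebesgue-integrable over `ℝ × (0,∞)`.  This is the absolute convergence
(Lemma 2.1) of the integral `∫_{C⁺_{1,2}} dφ_{e₁} ∧ dφ_{e₂}` defining the
Kontsevich weight of the graph with one vertex of the first type and two
vertices of the second type, fixed at `0` and `1` by the affine group. -/
theorem theta_smooth_and_jacobian_integrable :
    (∀ q : ℝ, ContDiffOn ℝ (⊤ : ℕ∞) (fun p : ℝ × ℝ => theta q p.1 p.2)
        {p : ℝ × ℝ | 0 < p.2}) ∧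
    MeasureTheory.IntegrableOn (fun p : ℝ × ℝ => thetaJacobian p.1 p.2)
        (Set.univ ×ˢ Set.Ioi (0 : ℝ)) volume := by
  have hmeas : MeasurableSet ((Set.univ : Set ℝ) ×ˢ Set.Ioi (0 : ℝ)) :=
    MeasurableSet.univ.prod measurableSet_Ioi
  refine ⟨fun q p hp => (contDiffAt_theta q hp).contDiffWithinAt, ?_⟩
  have hbound := ((integrableOn_poisson_kernel_mul 0).add
    (integrableOn_poisson_kernel_mul 1)).const_mul 2
  have hint : IntegrableOn
      (fun p : ℝ × ℝ => p.2 / ((p.1 ^ 2 + p.2 ^ 2) * ((p.1 - 1) ^ 2 + p.2 ^ 2)))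
      (Set.univ ×ˢ Set.Ioi (0 : ℝ)) volume := by
    refine Integrable.mono' hbound
      (Measurable.aestronglyMeasurable (by fun_prop)) ?_
    filter_upwards [ae_restrict_mem hmeas] with p hp
    have hp' : 0 < p.2 := hp.2
    rw [Real.norm_of_nonneg (by positivity)]
    exact jacobian_le_poisson_kernel p.1 hp'
  exact hint.congr_fun (fun p hp => (thetaJacobian_eq p.1 hp.2).symm) hmeas
end
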